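/- arXiv:1805.01538 — 4 statements merged into one kernel-verified Lean document; each statement's English description precedes it below -/
import Mathlib

section
/- For all integers m, n, r with n ≠ 0 (so that F(n) ≠ 0) and every nonnegative integer k: F(n+r) · ∑_{j=0}^{k} (-1)^{(r+1)·j} (F(r)/F(n))^j · G(m+r+(n+r)·j) = (-1)^r · F(n) · G(m) + (-1)^{(r+1)·k} · F(n) · (F(r)/F(n))^{k+1} · G(m+(k+1)·(n+r)). -/
/-- A solution of the Fibonacci recurrence on the integers that vanishes at `0` and `1` is zero. -/
lemma eq_zero_of_fib_rec {H : ℤ → ℝ} (hH : ∀ m : ℤ, H m = H (m - 1) + H (m - 2))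
    (h0 : H 0 = 0) (h1 : H 1 = 0) (n : ℤ) : H n = 0 := by
  suffices h : H n = 0 ∧ H (n + 1) = 0 from h.1
  induction n using Int.induction_on with
  | zero => exact ⟨h0, by simpa using h1⟩
  | succ i ih =>
    refine ⟨ih.2, ?_⟩
    rw [hH, show (i : ℤ) + 1 + 1 - 1 = i + 1 by ring, show (i : ℤ) + 1 + 1 - 2 = i by ring,
      ih.1, ih.2, add_zero]
  | pred i ih =>
    have h := hH (-(i : ℤ) + 1)
    rw [show -(i : ℤ) + 1 - 1 = -i by ring, show -(i : ℤ) + 1 - 2 = -i - 1 by ring,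
      ih.1, ih.2, zero_add] at h
    exact ⟨h.symm, by simpa using ih.1⟩

/-- A Cassini-type identity for generalized Fibonacci sequences. -/
lemma fib_cassini {F G : ℤ → ℝ}
    (hF0 : F 0 = 0) (hF1 : F 1 = 1) (hF : ∀ m : ℤ, F m = F (m - 1) + F (m - 2))
    (hG : ∀ m : ℤ, G m = G (m - 1) + G (m - 2)) (m r : ℤ) :
    F (r + 1) * G (m + r) - F r * G (m + r + 1) = (-1 : ℝ) ^ r * G m := by
  have step (r : ℤ) : F (r + 1 + 1) * G (m + (r + 1)) - F (r + 1) * G (m + (r + 1) + 1)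
      = -(F (r + 1) * G (m + r) - F r * G (m + r + 1)) := by
    have h1 := hF (r + 1 + 1)
    have h2 := hG (m + (r + 1) + 1)
    rw [show r + 1 + 1 - 1 = r + 1 by ring, show r + 1 + 1 - 2 = r by ring] at h1
    rw [show m + (r + 1) + 1 - 1 = m + r + 1 by ring,
      show m + (r + 1) + 1 - 2 = m + r by ring] at h2
    rw [h1, h2, ← add_assoc]
    ring
  induction r using Int.induction_on with
  | zero => simp [hF0, hF1]
  | succ i ih =>
    rw [step, ih, zpow_add_one₀ (by norm_num)]
    ring
  | pred i ih =>
    have h := step (-(i : ℤ) - 1)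
    rw [sub_add_cancel, ih] at h
    rw [sub_add_cancel, zpow_sub_one₀ (by norm_num)]
    linear_combination h

/-- Vajda's identity for generalized Fibonacci sequences. -/
lemma fib_vajda {F G : ℤ → ℝ}
    (hF0 : F 0 = 0) (hF1 : F 1 = 1) (hF : ∀ m : ℤ, F m = F (m - 1) + F (m - 2))
    (hG : ∀ m : ℤ, G m = G (m - 1) + G (m - 2)) (m n r : ℤ) :
    F (n + r) * G (m + r) = (-1 : ℝ) ^ r * F n * G m + F r * G (m + n + r) := by
  have key := eq_zero_of_fib_rec
    (H := fun n => F (n + r) * G (m + r) - (-1 : ℝ) ^ r * F n * G m - F r * G (m + n + r))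
    (fun n => by
      have h1 := hF (n + r)
      have h2 := hG (m + n + r)
      rw [show n + r - 1 = n - 1 + r by ring, show n + r - 2 = n - 2 + r by ring] at h1
      rw [show m + n + r - 1 = m + (n - 1) + r by ring,
        show m + n + r - 2 = m + (n - 2) + r by ring] at h2
      simp only [h1, h2, hF n]
      ring)
    (by simp [hF0])
    (by
      have h := fib_cassini hF0 hF1 hF hG m r
      simp only [hF1, add_comm 1 r, show m + 1 + r = m + r + 1 by ring]
      linarith) n
  linarith

/-- The Fibonacci numbers with nonzero integer index are nonzero. -/
lemma fib_ne_zero {F : ℤ → ℝ}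
    (hF0 : F 0 = 0) (hF1 : F 1 = 1) (hF : ∀ m : ℤ, F m = F (m - 1) + F (m - 2))
    {n : ℤ} (hn : n ≠ 0) : F n ≠ 0 := by
  have hpos (i : ℕ) : 0 ≤ F i ∧ 0 < F (i + 1) := by
    induction i with
    | zero => simp [hF0, hF1]
    | succ i ih =>
      push_cast
      refine ⟨ih.2.le, ?_⟩
      rw [hF, show (i : ℤ) + 1 + 1 - 1 = i + 1 by ring, show (i : ℤ) + 1 + 1 - 2 = i by ring]
      linarith
  have hpos' {r : ℤ} (hr : 0 < r) : 0 < F r := by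
    have h := (hpos (r - 1).toNat).2
    rwa [Int.toNat_of_nonneg (by omega), sub_add_cancel] at h
  rcases hn.lt_or_gt with h | h
  · intro h0
    have hv := fib_vajda hF0 hF1 hF hF 1 n (-n)
    have hp := hpos' (neg_pos.mpr h)
    simp [hF0, hF1, h0] at hv
    exact hp.ne hv
  · exact (hpos' h).ne'

/-- Weighted sum identity for generalized Fibonacci sequences
(Adegoke, Theorem 2, second identity). -/
theorem stmt_1 (F G : ℤ → ℝ)
    (hF0 : F 0 = 0) (hF1 : F 1 = 1)
    (hF : ∀ m : ℤ, F m = F (m - 1) + F (m - 2))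
    (hG : ∀ m : ℤ, G m = G (m - 1) + G (m - 2))
    (m n r : ℤ) (hn : n ≠ 0) (k : ℕ) :
    F (n + r) * ∑ j ∈ Finset.range (k + 1),
        (-1 : ℝ) ^ ((r + 1) * (j : ℤ)) * (F r / F n) ^ j * G (m + r + (n + r) * j)
      = (-1 : ℝ) ^ r * F n * G m
        + (-1 : ℝ) ^ ((r + 1) * (k : ℤ)) * F n * (F r / F n) ^ (k + 1)
            * G (m + (k + 1) * (n + r)) := by
  have hFn : F n ≠ 0 := fib_ne_zero hF0 hF1 hF hn
  have hvajda := fun M : ℤ => fib_vajda hF0 hF1 hF hG M n r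
  induction k with
  | zero =>
    have h := hvajda m
    simp only [zero_add, Finset.sum_range_one, Nat.cast_zero, mul_zero, zpow_zero, pow_zero,
      add_zero, pow_one, one_mul]
    rw [h, mul_div_cancel₀ _ hFn, add_assoc m n r]
  | succ k ih =>
    rw [Finset.sum_range_succ, mul_add, ih]
    have h := hvajda (m + (k + 1) * (n + r))
    have hr : (-1 : ℝ) ^ r * (-1 : ℝ) ^ r = 1 := by
      rw [← mul_zpow]
      norm_num
    have hsign : (-1 : ℝ) ^ ((r + 1) * ((k + 1 : ℕ) : ℤ))
        = -((-1 : ℝ) ^ ((r + 1) * (k : ℤ)) * (-1 : ℝ) ^ r) := by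
      rw [Nat.cast_succ, mul_add, mul_one, zpow_add₀ (by norm_num), zpow_add_one₀ (by norm_num)]
      ring
    have hq : F r = F n * (F r / F n) := (mul_div_cancel₀ _ hFn).symm
    rw [show m + r + (n + r) * ((k + 1 : ℕ) : ℤ) = m + (k + 1) * (n + r) + r by push_cast; ring,
      show m + (((k + 1 : ℕ) : ℤ) + 1) * (n + r) = m + (k + 1) * (n + r) + n + r by
        push_cast; ring, hsign, pow_succ _ (k + 1)]
    generalize F r / F n = q at *
    rw [hq] at h
    linear_combination (-((-1 : ℝ) ^ ((r + 1) * (k : ℤ)) * (-1 : ℝ) ^ r) * q ^ (k + 1)) * h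
      - (-1 : ℝ) ^ ((r + 1) * (k : ℤ)) * q ^ (k + 1) * F n * G (m + (k + 1) * (n + r)) * hr
end

section
/- For all integers m, n and every nonnegative integer k: ∑_{j=0}^{k} ∑_{s=0}^{k−j} (-1)^{n·(j+s)} · C(k,j) · C(k−j,s) · F(n)^{j+s} · G(m−2n·k+(n−1)·j+(n+1)·s) = (-1)^{n·k} · G(m), where C(k,j) denotes the binomial coefficient. -/
/-- Two two-sided sequences satisfying the Fibonacci recurrence and agreeing at `0` and `1`
are equal. -/
theorem fibRec_ext {G H : ℤ → ℝ}
    (hG : ∀ m : ℤ, G m = G (m - 1) + G (m - 2))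
    (hH : ∀ m : ℤ, H m = H (m - 1) + H (m - 2))
    (h0 : G 0 = H 0) (h1 : G 1 = H 1) (m : ℤ) : G m = H m := by
  suffices h : G m = H m ∧ G (m + 1) = H (m + 1) from h.1
  induction m using Int.induction_on with
  | zero => exact ⟨h0, by simpa using h1⟩
  | succ i ih =>
    refine ⟨ih.2, ?_⟩
    have e1 : (i : ℤ) + 1 + 1 - 1 = i + 1 := by ring
    have e2 : (i : ℤ) + 1 + 1 - 2 = i := by ring
    rw [hG, hH, e1, e2, ih.1, ih.2]
  | pred i ih =>
    have hg := hG (-(i : ℤ) + 1)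
    have hh := hH (-(i : ℤ) + 1)
    have e1 : -(i : ℤ) + 1 - 1 = -i := by ring
    have e2 : -(i : ℤ) + 1 - 2 = -i - 1 := by ring
    rw [e1, e2] at hg hh
    refine ⟨by linarith [ih.1, ih.2], ?_⟩
    rw [sub_add_cancel]
    exact ih.1

theorem zpow_fibRec {x : ℝ} (hx : x ^ 2 = x + 1) (m : ℤ) :
    x ^ m = x ^ (m - 1) + x ^ (m - 2) := by
  have hx0 : x ≠ 0 := by
    rintro rfl
    norm_num at hx
  have e1 : m = m - 2 + 2 := by ring
  have e2 : m - 1 = m - 2 + 1 := by ring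
  rw [e2, zpow_add₀ hx0, zpow_one]
  nth_rewrite 1 [e1]
  rw [zpow_add₀ hx0, zpow_ofNat, hx]
  ring

/-- Binet's formula for generalized Fibonacci sequences indexed by the integers. -/
theorem binet_of_fibRec {G : ℤ → ℝ} (hG : ∀ m : ℤ, G m = G (m - 1) + G (m - 2))
    {x y : ℝ} (hx : x ^ 2 = x + 1) (hy : y ^ 2 = y + 1) (hxy : x ≠ y) (m : ℤ) :
    G m = (G 1 - G 0 * y) / (x - y) * x ^ m + (G 0 * x - G 1) / (x - y) * y ^ m := by
  have hd : x - y ≠ 0 := sub_ne_zero.mpr hxy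
  refine fibRec_ext (H := fun m => (G 1 - G 0 * y) / (x - y) * x ^ m
    + (G 0 * x - G 1) / (x - y) * y ^ m) hG (fun m => ?_) ?_ ?_ m
  · rw [zpow_fibRec hx m, zpow_fibRec hy m]
    ring
  · simp only [zpow_zero]
    field_simp
    ring
  · simp only [zpow_one]
    field_simp
    ring

/-- A trinomial expansion written as a double binomial sum. -/
theorem sum_choose_mul_choose_mul_zpow {x : ℝ} (hx : x ≠ 0) (c : ℝ) (m n : ℤ) (k : ℕ) :
    ∑ j ∈ Finset.range (k + 1), ∑ s ∈ Finset.range (k - j + 1),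
        (Nat.choose k j : ℝ) * (Nat.choose (k - j) s : ℝ) * c ^ (j + s)
          * x ^ (m - 2 * n * k + (n - 1) * j + (n + 1) * s)
      = (x ^ (-2 * n) * (c * x ^ (n - 1) + (c * x ^ (n + 1) + 1))) ^ k * x ^ m := by
  rw [mul_pow, add_pow, Finset.mul_sum, Finset.sum_mul]
  refine Finset.sum_congr rfl fun j _ => ?_
  rw [add_pow, Finset.mul_sum, Finset.sum_mul, Finset.mul_sum, Finset.sum_mul]
  refine Finset.sum_congr rfl fun s _ => ?_
  have e : m - 2 * n * k + (n - 1) * j + (n + 1) * s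
      = m + -2 * n * k + (n - 1) * j + (n + 1) * s := by ring
  rw [e, zpow_add₀ hx, zpow_add₀ hx, zpow_add₀ hx, zpow_mul x (-2 * n), zpow_mul x (n - 1),
    zpow_mul x (n + 1)]
  simp only [zpow_natCast, one_pow, mul_pow]
  ring

theorem zpow_trinomial_eq_neg_one_zpow {x y f : ℝ} (hmul : x * y = -1)
    {n : ℤ} (hf : f * (x - y) = x ^ n - y ^ n) :
    x ^ (-2 * n) * ((-1) ^ n * f * x ^ (n - 1) + ((-1) ^ n * f * x ^ (n + 1) + 1))
      = (-1) ^ n := by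
  have hx : x ≠ 0 := left_ne_zero_of_mul (hmul ▸ neg_ne_zero.mpr one_ne_zero)
  have hinv : x⁻¹ = -y := inv_eq_of_mul_eq_one_right (by linarith)
  have hp : x ^ n * y ^ n = (-1) ^ n := by rw [← mul_zpow, hmul]
  have hs : ((-1 : ℝ) ^ n) * (-1) ^ n = 1 := by rw [← mul_zpow]; norm_num
  have hn : x ^ (-2 * n) * (x ^ n * x ^ n) = 1 := by
    rw [← zpow_add₀ hx, ← zpow_add₀ hx]
    ring_nf
    simp
  rw [zpow_sub_one₀ hx, zpow_add_one₀ hx, hinv]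
  linear_combination (x ^ (-2 * n) * (-1) ^ n * x ^ n) * hf + (-1) ^ n * hn
    - x ^ (-2 * n) * (-1) ^ n * hp - x ^ (-2 * n) * hs

/-- Weighted double binomial sum identity for generalized Fibonacci sequences. -/
theorem stmt_7 (F G : ℤ → ℝ)
    (hF0 : F 0 = 0) (hF1 : F 1 = 1)
    (hF : ∀ m : ℤ, F m = F (m - 1) + F (m - 2))
    (hG : ∀ m : ℤ, G m = G (m - 1) + G (m - 2))
    (m n : ℤ) (k : ℕ) :
    ∑ j ∈ Finset.range (k + 1), ∑ s ∈ Finset.range (k - j + 1),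
        (-1 : ℝ) ^ (n * ((j : ℤ) + s)) * (Nat.choose k j : ℝ)
          * (Nat.choose (k - j) s : ℝ) * F n ^ (j + s)
          * G (m - 2 * n * k + (n - 1) * j + (n + 1) * s)
      = (-1 : ℝ) ^ (n * (k : ℤ)) * G m := by
  obtain ⟨x, y, hadd, hmul, hxy⟩ : ∃ x y : ℝ, x + y = 1 ∧ x * y = -1 ∧ x ≠ y :=
    ⟨Real.goldenRatio, Real.goldenConj, Real.goldenRatio_add_goldenConj,
      Real.goldenRatio_mul_goldenConj,
      (Real.goldenConj_neg.trans Real.goldenRatio_pos).ne'⟩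
  have hx : x ^ 2 = x + 1 := by linear_combination x * hadd - hmul
  have hy : y ^ 2 = y + 1 := by linear_combination y * hadd - hmul
  have hx0 : x ≠ 0 := left_ne_zero_of_mul (hmul ▸ neg_ne_zero.mpr one_ne_zero)
  have hy0 : y ≠ 0 := right_ne_zero_of_mul (hmul ▸ neg_ne_zero.mpr one_ne_zero)
  have hd : x - y ≠ 0 := sub_ne_zero.mpr hxy
  have hFn : F n * (x - y) = x ^ n - y ^ n := by
    rw [binet_of_fibRec hF hx hy hxy n, hF0, hF1]
    field_simp
    ring
  have hX := sum_choose_mul_choose_mul_zpow hx0 ((-1) ^ n * F n) m n k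
  have hY := sum_choose_mul_choose_mul_zpow hy0 ((-1) ^ n * F n) m n k
  rw [zpow_trinomial_eq_neg_one_zpow hmul hFn] at hX
  rw [zpow_trinomial_eq_neg_one_zpow (x := y) (y := x) (by linarith)
    (by linarith)] at hY
  have hB := binet_of_fibRec hG hx hy hxy
  generalize (G 1 - G 0 * y) / (x - y) = A at hB
  generalize (G 0 * x - G 1) / (x - y) = B at hB
  calc
    _ = A * ((-1) ^ n) ^ k * x ^ m + B * ((-1) ^ n) ^ k * y ^ m := by
      rw [mul_assoc A, mul_assoc B, ← hX, ← hY]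
      simp only [Finset.mul_sum, ← Finset.sum_add_distrib]
      refine Finset.sum_congr rfl fun j _ => Finset.sum_congr rfl fun s _ => ?_
      rw [hB, ← Nat.cast_add, zpow_mul, zpow_natCast, mul_pow]
      ring
    _ = _ := by
      rw [hB m, zpow_mul, zpow_natCast]
      ring
end

section
/- Let G and H be generalized Fibonacci sequences. For all integers m, n, r with G(n+r) ≠ 0 and every nonnegative integer k: ∑_{j=0}^{k} ∑_{s=0}^{j} (-1)^{n·(j+s)+s} · C(k,j) · C(j,s) · (G(0)^{j−s} · G(n)^s / G(n+r)^j) · H(m+n·k+(r−n)·j+n·s) = (-1)^{n·k} · (G(r)/G(n+r))^k · H(m), where C(k,j) denotes the binomial coefficient. -/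
/-- Binet's formula for a two-sided sequence satisfying the Fibonacci recurrence. -/
theorem exists_binet {H : ℤ → ℝ} (hH : ∀ m : ℤ, H m = H (m - 1) + H (m - 2)) {x y : ℝ}
    (hxy : x - y ≠ 0) (hx : x ^ 2 = x + 1) (hy : y ^ 2 = y + 1) :
    ∃ A B : ℝ, ∀ m : ℤ, H m = A * x ^ m + B * y ^ m := by
  have hx0 : x ≠ 0 := by rintro rfl; norm_num at hx
  have hy0 : y ≠ 0 := by rintro rfl; norm_num at hy
  have rec_zpow (z : ℝ) (hz0 : z ≠ 0) (hz : z ^ 2 = z + 1) (i : ℤ) :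
      z ^ (i + 2) = z ^ (i + 1) + z ^ i := by
    rw [zpow_add₀ hz0, zpow_add₀ hz0, zpow_ofNat, zpow_one, hz]
    ring
  have hrec (i : ℤ) : H (i + 2) = H (i + 1) + H i := by
    rw [hH (i + 2)]
    congr 2 <;> ring
  refine ⟨(H 1 - y * H 0) / (x - y), (x * H 0 - H 1) / (x - y), fun m ↦ ?_⟩
  set A := (H 1 - y * H 0) / (x - y) with hA
  set B := (x * H 0 - H 1) / (x - y) with hB
  suffices h : H m = A * x ^ m + B * y ^ m ∧ H (m + 1) = A * x ^ (m + 1) + B * y ^ (m + 1) from h.1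
  induction m using Int.induction_on with
  | zero =>
    constructor
    · simp only [zpow_zero, hA, hB]
      field_simp
      ring
    · simp only [zero_add, zpow_one, hA, hB]
      field_simp
      ring
  | succ i ih =>
    refine ⟨ih.2, ?_⟩
    rw [add_assoc, one_add_one_eq_two, hrec, rec_zpow x hx0 hx, rec_zpow y hy0 hy, ih.1, ih.2]
    ring
  | pred i ih =>
    rw [sub_add_cancel]
    refine ⟨?_, ih.1⟩
    have h1 := hrec (-(i : ℤ) - 1)
    have h2 := rec_zpow x hx0 hx (-(i : ℤ) - 1)
    have h3 := rec_zpow y hy0 hy (-(i : ℤ) - 1)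
    rw [show -(i : ℤ) - 1 + 2 = -(i : ℤ) + 1 by ring, sub_add_cancel] at h1 h2 h3
    linear_combination ih.2 - ih.1 - h1 + A * h2 + B * h3

/-- The double binomial sum of powers of `x` is a trinomial expansion. -/
theorem sum_sum_choose_mul_zpow {x : ℝ} (hx : x ≠ 0) (a b d : ℝ) (m n r : ℤ) (k : ℕ) :
    ∑ j ∈ Finset.range (k + 1), ∑ s ∈ Finset.range (j + 1),
        (-1 : ℝ) ^ (n * ((j : ℤ) + s) + s) * (Nat.choose k j : ℝ)
          * (Nat.choose j s : ℝ)
          * (a ^ (j - s) * b ^ s / d ^ j)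
          * x ^ (m + n * k + (r - n) * j + n * s)
      = (-b / d * x ^ (n + r) + (-1) ^ n * (a / d) * x ^ r + x ^ n) ^ k * x ^ m := by
  rw [add_pow, Finset.sum_mul]
  refine Finset.sum_congr rfl fun j hj ↦ ?_
  rw [add_pow, Finset.sum_mul, Finset.sum_mul, Finset.sum_mul]
  refine Finset.sum_congr rfl fun s hs ↦ ?_
  obtain ⟨l, rfl⟩ := Nat.exists_eq_add_of_le (Finset.mem_range_succ_iff.mp hj)
  obtain ⟨i, rfl⟩ := Nat.exists_eq_add_of_le (Finset.mem_range_succ_iff.mp hs)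
  have h_neg : (-1 : ℝ) ≠ 0 := by norm_num
  have h_sign : (-1 : ℝ) ^ (n * (((s + i : ℕ) : ℤ) + s) + s) = ((-1) ^ n) ^ i * (-1) ^ s := by
    rw [show n * (((s + i : ℕ) : ℤ) + s) + s = n * i + 2 * (n * s) + s by push_cast; ring,
      zpow_add₀ h_neg, zpow_add₀ h_neg, zpow_mul, zpow_mul (-1 : ℝ) 2]
    simp
  have h_pow : x ^ (m + n * ((s + i + l : ℕ) : ℤ) + (r - n) * ((s + i : ℕ) : ℤ) + n * s)
      = (x ^ (n + r)) ^ s * (x ^ r) ^ i * (x ^ n) ^ l * x ^ m := by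
    simp only [← zpow_natCast, ← zpow_mul, ← zpow_add₀ hx]
    congr 1
    push_cast
    ring
  rw [h_sign, h_pow, Nat.add_sub_cancel_left, Nat.add_sub_cancel_left, mul_pow, mul_pow, mul_pow,
    div_pow, div_pow, neg_pow b, pow_add d]
  ring

/-- The case `H = (x ^ ·)` of the identity relating two Fibonacci-type sequences. -/
theorem binet_shift_relation {x y : ℝ} (hx : x ≠ 0) (hy : y ≠ 0) (hxy : x * y = -1) {G : ℤ → ℝ}
    {A B : ℝ} (hG : ∀ m : ℤ, G m = A * x ^ m + B * y ^ m) {n r : ℤ} (hGnr : G (n + r) ≠ 0) :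
    -G n / G (n + r) * x ^ (n + r) + (-1) ^ n * (G 0 / G (n + r)) * x ^ r + x ^ n
      = (-1) ^ n * (G r / G (n + r)) := by
  field_simp
  rw [← hxy, mul_zpow, hG n, hG 0, hG r, hG (n + r), zpow_add₀ hx, zpow_add₀ hy]
  simp only [zpow_zero]
  ring


/-- Weighted double binomial sum identity for two generalized Fibonacci sequences. -/
theorem stmt_13 (G H : ℤ → ℝ)
    (hG : ∀ m : ℤ, G m = G (m - 1) + G (m - 2))
    (hH : ∀ m : ℤ, H m = H (m - 1) + H (m - 2))
    (m n r : ℤ) (hGnr : G (n + r) ≠ 0) (k : ℕ) :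
    ∑ j ∈ Finset.range (k + 1), ∑ s ∈ Finset.range (j + 1),
        (-1 : ℝ) ^ (n * ((j : ℤ) + s) + s) * (Nat.choose k j : ℝ)
          * (Nat.choose j s : ℝ)
          * (G 0 ^ (j - s) * G n ^ s / G (n + r) ^ j)
          * H (m + n * k + (r - n) * j + n * s)
      = (-1 : ℝ) ^ (n * (k : ℤ)) * (G r / G (n + r)) ^ k * H m := by
  obtain ⟨x, y, hsub, hx2, hy2, hxy, hx, hy⟩ : ∃ x y : ℝ, x - y ≠ 0 ∧ x ^ 2 = x + 1 ∧
      y ^ 2 = y + 1 ∧ x * y = -1 ∧ x ≠ 0 ∧ y ≠ 0 :=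
    ⟨Real.goldenRatio, Real.goldenConj, by simp [Real.goldenRatio_sub_goldenConj],
      Real.goldenRatio_sq, Real.goldenConj_sq, Real.goldenRatio_mul_goldenConj,
      Real.goldenRatio_ne_zero, Real.goldenConj_ne_zero⟩
  obtain ⟨A, B, hAB⟩ := exists_binet hG hsub hx2 hy2
  obtain ⟨C, D, hCD⟩ := exists_binet hH hsub hx2 hy2
  have h_x := sum_sum_choose_mul_zpow hx (G 0) (G n) (G (n + r)) m n r k
  have h_y := sum_sum_choose_mul_zpow hy (G 0) (G n) (G (n + r)) m n r k
  rw [binet_shift_relation hx hy hxy hAB hGnr, mul_pow, ← zpow_natCast, ← zpow_mul] at h_x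
  rw [binet_shift_relation hy hx (mul_comm x y ▸ hxy) (fun i ↦ (hAB i).trans (add_comm _ _)) hGnr,
    mul_pow, ← zpow_natCast, ← zpow_mul] at h_y
  rw [hCD m, mul_add, mul_left_comm _ C, mul_left_comm _ D, ← h_x, ← h_y]
  simp only [Finset.mul_sum, ← Finset.sum_add_distrib]
  refine Finset.sum_congr rfl fun j _ ↦ Finset.sum_congr rfl fun s _ ↦ ?_
  rw [hCD]
  ring
end

section
/- Let G and H be generalized Fibonacci sequences. For all integers m, n, r with G(r) ≠ 0 and every nonnegative integer k: ∑_{j=0}^{k} ∑_{s=0}^{k−j} (-1)^{n·(j+s)+j} · C(k,j) · C(k−j,s) · (G(n+r)^j · G(n)^s / G(r)^{j+s}) · H(m−r·k+n·j+(n+r)·s) = (G(0)/G(r))^k · H(m), where C(k,j) denotes the binomial coefficient. -/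
/-- Every generalized Fibonacci sequence on `ℤ` has a Binet formula. -/
lemma exists_binet_s17 (G : ℤ → ℝ) (hG : ∀ m : ℤ, G m = G (m - 1) + G (m - 2)) :
    ∃ a b : ℝ, ∀ m : ℤ, G m = a * Real.goldenRatio ^ m + b * Real.goldenConj ^ m := by
  have h5 : Real.goldenRatio - Real.goldenConj ≠ 0 := by
    rw [Real.goldenRatio_sub_goldenConj]; positivity
  have hstep : ∀ x : ℝ, x ≠ 0 → x ^ 2 = x + 1 → ∀ m : ℤ, x ^ (m + 2) = x ^ (m + 1) + x ^ m := by
    intro x hx h m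
    rw [zpow_add₀ hx, zpow_add₀ hx, zpow_one, zpow_ofNat, h]
    ring
  have hφ := hstep _ Real.goldenRatio_ne_zero Real.goldenRatio_sq
  have hψ := hstep _ Real.goldenConj_ne_zero Real.goldenConj_sq
  have hG' : ∀ m : ℤ, G (m + 2) = G (m + 1) + G m := by
    intro m
    have := hG (m + 2)
    rwa [show m + 2 - 1 = m + 1 by ring, show m + 2 - 2 = m by ring] at this
  refine ⟨(G 1 - G 0 * Real.goldenConj) / (Real.goldenRatio - Real.goldenConj),
    (G 0 * Real.goldenRatio - G 1) / (Real.goldenRatio - Real.goldenConj), ?_⟩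
  set a := (G 1 - G 0 * Real.goldenConj) / (Real.goldenRatio - Real.goldenConj) with ha
  set b := (G 0 * Real.goldenRatio - G 1) / (Real.goldenRatio - Real.goldenConj) with hb
  suffices h : ∀ m : ℤ, G m = a * Real.goldenRatio ^ m + b * Real.goldenConj ^ m ∧
      G (m + 1) = a * Real.goldenRatio ^ (m + 1) + b * Real.goldenConj ^ (m + 1) from
    fun m => (h m).1
  intro m
  induction m using Int.induction_on with
  | zero =>
    simp only [zero_add, zpow_zero, zpow_one, ha, hb]
    constructor <;> field_simp <;> ring
  | succ i ih =>
    refine ⟨ih.2, ?_⟩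
    rw [add_assoc, one_add_one_eq_two, hG', hφ, hψ, ih.1, ih.2]
    ring
  | pred i ih =>
    have e : -(i : ℤ) - 1 + 1 = -i := by ring
    have e' : -(i : ℤ) - 1 + 2 = -i + 1 := by ring
    have h1 := hG' (-(i : ℤ) - 1)
    have h2 := hφ (-(i : ℤ) - 1)
    have h3 := hψ (-(i : ℤ) - 1)
    rw [e, e'] at h1 h2 h3
    rw [e]
    refine ⟨?_, ih.1⟩
    rw [ih.1, ih.2, h2, h3] at h1
    linarith

/-- The trinomial theorem as a nested double sum. -/
lemma sum_sum_trinomial {R : Type*} [CommSemiring R] (x y z : R) (k : ℕ) :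
    ∑ j ∈ Finset.range (k + 1), ∑ s ∈ Finset.range (k - j + 1),
      (Nat.choose k j : R) * (Nat.choose (k - j) s : R) * (y ^ j * z ^ s * x ^ (k - j - s))
      = (x + y + z) ^ k := by
  rw [show x + y + z = y + (z + x) by ring, add_pow]
  refine Finset.sum_congr rfl fun j _ => ?_
  rw [add_pow, Finset.mul_sum, Finset.sum_mul]
  refine Finset.sum_congr rfl fun s _ => ?_
  ring

/-- The first-order identity for the geometric sequence at one of two numbers with product `-1`. -/
lemma geometric_first_order (G : ℤ → ℝ) {x y a b : ℝ} (hxy : x * y = -1)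
    (hG : ∀ m : ℤ, G m = a * x ^ m + b * y ^ m) (n r : ℤ) :
    G r * x ^ (-r) - (-1) ^ n * G (n + r) * x ^ (n - r) + (-1) ^ n * G n * x ^ n = G 0 := by
  have hx : x ≠ 0 := by rintro rfl; simp at hxy
  have hy : y ≠ 0 := by rintro rfl; simp at hxy
  have hn : x ^ n * y ^ n = (-1) ^ n := by rw [← mul_zpow, hxy]
  have hs : ((-1 : ℝ) ^ n) * (-1) ^ n = 1 := by rw [← mul_zpow]; simp
  have hr : x ^ r * x ^ (-r) = 1 := by rw [← zpow_add₀ hx]; simp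
  simp only [hG, zpow_add₀ hx, zpow_add₀ hy, sub_eq_add_neg, zpow_zero]
  generalize x ^ n = X at *
  generalize y ^ n = Y at *
  generalize (-1 : ℝ) ^ n = σ at *
  generalize x ^ (-r) = U at *
  generalize x ^ r = V at *
  generalize y ^ r = W at *
  linear_combination (a - σ * a * X ^ 2) * hr + (σ * b - σ * b * W * U) * hn
    + (b - b * W * U) * hs

/-- The double sum for a geometric sequence at one of two numbers with product `-1`. -/
lemma geometric_double_sum (G : ℤ → ℝ) {x y a b : ℝ} (hxy : x * y = -1)
    (hG : ∀ m : ℤ, G m = a * x ^ m + b * y ^ m) (m n r : ℤ) (hGr : G r ≠ 0) (k : ℕ) :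
    ∑ j ∈ Finset.range (k + 1), ∑ s ∈ Finset.range (k - j + 1),
        (-1 : ℝ) ^ (n * ((j : ℤ) + s) + j) * (Nat.choose k j : ℝ)
          * (Nat.choose (k - j) s : ℝ)
          * (G (n + r) ^ j * G n ^ s / G r ^ (j + s))
          * x ^ (m - r * k + n * j + (n + r) * s)
      = (G 0 / G r) ^ k * x ^ m := by
  have hx : x ≠ 0 := by rintro rfl; simp at hxy
  have key : x ^ (-r) + -((-1) ^ n * G (n + r) / G r * x ^ (n - r))
      + (-1) ^ n * G n / G r * x ^ n = G 0 / G r := by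
    rw [← geometric_first_order G hxy hG n r]
    field_simp
    ring
  rw [← key, ← sum_sum_trinomial, Finset.sum_mul]
  refine Finset.sum_congr rfl fun j hj => ?_
  rw [Finset.sum_mul]
  refine Finset.sum_congr rfl fun s hs => ?_
  rw [Finset.mem_range] at hj hs
  obtain ⟨t, rfl⟩ : ∃ t, k = j + s + t := ⟨k - j - s, by omega⟩
  have ht : j + s + t - j - s = t := by omega
  have hsign : (-1 : ℝ) ^ (n * ((j : ℤ) + s) + j) = ((-1) ^ n) ^ j * ((-1) ^ n) ^ s * (-1) ^ j := by
    rw [zpow_add₀ (by norm_num), mul_add, zpow_add₀ (by norm_num), zpow_mul, zpow_mul]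
    simp only [zpow_natCast]
  have hpow : x ^ (m - r * ((j + s + t : ℕ) : ℤ) + n * j + (n + r) * s)
      = (x ^ (n - r)) ^ j * (x ^ n) ^ s * (x ^ (-r)) ^ t * x ^ m := by
    simp only [← zpow_natCast, ← zpow_mul, ← zpow_add₀ hx]
    congr 1
    push_cast
    ring
  rw [ht, hsign, hpow, neg_pow (_ * _ : ℝ) j]
  simp only [mul_pow, div_pow, pow_add]
  field_simp

/-- Weighted double binomial sum identity for two generalized Fibonacci sequences. -/
theorem stmt_17 (G H : ℤ → ℝ)
    (hG : ∀ m : ℤ, G m = G (m - 1) + G (m - 2))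
    (hH : ∀ m : ℤ, H m = H (m - 1) + H (m - 2))
    (m n r : ℤ) (hGr : G r ≠ 0) (k : ℕ) :
    ∑ j ∈ Finset.range (k + 1), ∑ s ∈ Finset.range (k - j + 1),
        (-1 : ℝ) ^ (n * ((j : ℤ) + s) + j) * (Nat.choose k j : ℝ)
          * (Nat.choose (k - j) s : ℝ)
          * (G (n + r) ^ j * G n ^ s / G r ^ (j + s))
          * H (m - r * k + n * j + (n + r) * s)
      = (G 0 / G r) ^ k * H m := by
  obtain ⟨a, b, hab⟩ := exists_binet_s17 G hG
  obtain ⟨c, d, hcd⟩ := exists_binet_s17 H hH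
  have hφ := geometric_double_sum G Real.goldenRatio_mul_goldenConj hab m n r hGr k
  have hψ := geometric_double_sum G Real.goldenConj_mul_goldenRatio
    (fun i => (hab i).trans (add_comm _ _)) m n r hGr k
  rw [hcd m, mul_add, mul_left_comm, mul_left_comm _ d, ← hφ, ← hψ]
  simp only [Finset.mul_sum, ← Finset.sum_add_distrib]
  refine Finset.sum_congr rfl fun j _ => Finset.sum_congr rfl fun s _ => ?_
  rw [hcd]
  ring
end
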